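/- arXiv:1509.08349 — 7 statements merged into one kernel-verified Lean document; each statement's English description precedes it below -/
import Mathlib

section
/- (Piola identity.) For each i ∈ {1,2,3} and every x ∈ U one has ∑_{j=1}^{3} ∂_j (J(x) A_{ij}(x)) = 0, where J = det Dψ and A = ((Dψ)⁻¹)ᵀ. -/
open Matrix

/-- The Jacobian matrix `Dψ(x)` of `ψ : ℝ³ → ℝ³`, entries `(Dψ)_{ij} = ∂ψ_i/∂x_j`. -/
noncomputable def jacS (ψ : (Fin 3 → ℝ) → Fin 3 → ℝ) (x : Fin 3 → ℝ) :
    Matrix (Fin 3) (Fin 3) ℝ :=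
  Matrix.of fun i j => fderiv ℝ (fun y => ψ y i) x (Pi.single j 1)

/-- First partial derivatives are differentiable and second partials commute. -/
theorem partials_aux {U : Set (Fin 3 → ℝ)} (hU : IsOpen U)
    {ψ : (Fin 3 → ℝ) → Fin 3 → ℝ} (hψ : ContDiffOn ℝ 2 ψ U) {x : Fin 3 → ℝ} (hx : x ∈ U)
    (i : Fin 3) :
    (∀ j, DifferentiableAt ℝ (fun y => jacS ψ y i j) x) ∧
    ∀ j k, fderiv ℝ (fun y => jacS ψ y i j) x (Pi.single k 1) =
      fderiv ℝ (fun y => jacS ψ y i k) x (Pi.single j 1) := by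
  have hc : ContDiffAt ℝ 2 (fun y => ψ y i) x :=
    (contDiffAt_pi.1 (hψ.contDiffAt (hU.mem_nhds hx))) i
  have hd : DifferentiableAt ℝ (fderiv ℝ (fun y => ψ y i)) x :=
    (hc.fderiv_right (m := 1) (by norm_num)).differentiableAt (by norm_num)
  have hs : IsSymmSndFDerivAt ℝ (fun y => ψ y i) x := hc.isSymmSndFDerivAt (by simp)
  have hf : ∀ j k, fderiv ℝ (fun y => jacS ψ y i j) x (Pi.single k 1) =
      fderiv ℝ (fderiv ℝ (fun y => ψ y i)) x (Pi.single k 1) (Pi.single j 1) := by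
    intro j k
    have h := hd.hasFDerivAt.clm_apply (hasFDerivAt_const (Pi.single j (1:ℝ)) x)
    have h2 : fderiv ℝ (fun y => jacS ψ y i j) x = _ := h.fderiv
    rw [h2]
    simp
  refine ⟨fun j => ?_, fun j k => ?_⟩
  · exact (hd.hasFDerivAt.clm_apply (hasFDerivAt_const (Pi.single j (1:ℝ)) x)).differentiableAt
  · rw [hf, hf]
    exact hs _ _

/-- Derivative of a 2x2 minor. -/
theorem minor_aux {a b c d : (Fin 3 → ℝ) → ℝ} {x : Fin 3 → ℝ} (v : Fin 3 → ℝ)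
    (ha : DifferentiableAt ℝ a x) (hb : DifferentiableAt ℝ b x)
    (hc : DifferentiableAt ℝ c x) (hd : DifferentiableAt ℝ d x) :
    fderiv ℝ (fun y => a y * b y - c y * d y) x v =
      a x * fderiv ℝ b x v + b x * fderiv ℝ a x v
        - (c x * fderiv ℝ d x v + d x * fderiv ℝ c x v) := by
  have h : fderiv ℝ (fun y => a y * b y - c y * d y) x = _ :=
    ((ha.hasFDerivAt.mul hb.hasFDerivAt).sub (hc.hasFDerivAt.mul hd.hasFDerivAt)).fderiv
  rw [h]
  simp

/-- Derivative of a negated 2x2 minor. -/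
theorem minor_aux_neg {a b c d : (Fin 3 → ℝ) → ℝ} {x : Fin 3 → ℝ} (v : Fin 3 → ℝ)
    (ha : DifferentiableAt ℝ a x) (hb : DifferentiableAt ℝ b x)
    (hc : DifferentiableAt ℝ c x) (hd : DifferentiableAt ℝ d x) :
    fderiv ℝ (fun y => -(a y * b y) + c y * d y) x v =
      - (a x * fderiv ℝ b x v + b x * fderiv ℝ a x v)
        + (c x * fderiv ℝ d x v + d x * fderiv ℝ c x v) := by
  have h : fderiv ℝ (fun y => -(a y * b y) + c y * d y) x = _ :=
    ((ha.hasFDerivAt.mul hb.hasFDerivAt).neg.add (hc.hasFDerivAt.mul hd.hasFDerivAt)).fderiv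
  rw [h]
  simp

/-- Piola identity: `∑_j ∂_j (J A_{ij}) = 0` on `U`, where
`J = det Dψ` and `A = ((Dψ)⁻¹)ᵀ`. -/
theorem piola_identity (U : Set (Fin 3 → ℝ)) (hU : IsOpen U)
    (ψ : (Fin 3 → ℝ) → Fin 3 → ℝ) (hψ : ContDiffOn ℝ 2 ψ U)
    (hinv : ∀ x ∈ U, (jacS ψ x).det ≠ 0) :
    ∀ x ∈ U, ∀ i : Fin 3,
      ∑ j : Fin 3,
        fderiv ℝ (fun y => (jacS ψ y).det * ((jacS ψ y)⁻¹)ᵀ i j) x (Pi.single j 1)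
        = 0 := by
  intro x hx i
  have hadj : ∀ j, fderiv ℝ (fun y => (jacS ψ y).det * ((jacS ψ y)⁻¹)ᵀ i j) x =
      fderiv ℝ (fun y => (jacS ψ y).adjugate j i) x := by
    intro j
    apply Filter.EventuallyEq.fderiv_eq
    filter_upwards [hU.mem_nhds hx] with y hy
    rw [Matrix.transpose_apply, Matrix.inv_def, Matrix.smul_apply, Ring.inverse_eq_inv',
      smul_eq_mul, mul_inv_cancel_left₀ (hinv y hy)]
  simp only [hadj]
  have hD : ∀ i j, DifferentiableAt ℝ (fun y => jacS ψ y i j) x :=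
    fun i => (partials_aux hU hψ hx i).1
  have hS := fun i => (partials_aux hU hψ hx i).2
  have h01 := fun i => hS i 0 1
  have h02 := fun i => hS i 0 2
  have h12 := fun i => hS i 1 2
  fin_cases i <;>
  · simp only [Fin.sum_univ_three, Matrix.adjugate_fin_three]
    simp only [Fin.zero_eta, Fin.mk_one, Fin.reduceFinMk, Matrix.of_apply, Matrix.cons_val]
    simp only [minor_aux _ (hD _ _) (hD _ _) (hD _ _) (hD _ _),
      minor_aux_neg _ (hD _ _) (hD _ _) (hD _ _) (hD _ _), h01, h02, h12]
    ring
end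

section
/- If in addition J(x) = det Dψ(x) = 1 for all x ∈ U, then for every C¹ vector field X : U → ℝ³, div_A X = div(Aᵀ X); that is, ∑_{i,j} A_{ij} ∂_j X_i(x) = ∑_{j} ∂_j ( ∑_{i} A_{ij} X_i )(x) for all x ∈ U, where div_A X := ∑_{i,j} A_{ij} ∂_j X_i. -/
open Matrix

/-- Entries of the Jacobian are differentiable, with symmetric second derivatives. -/
theorem jacS_hasFDerivAt (U : Set (Fin 3 → ℝ)) (hU : IsOpen U)
    (ψ : (Fin 3 → ℝ) → Fin 3 → ℝ) (hψ : ContDiffOn ℝ 2 ψ U) (x : Fin 3 → ℝ) (hx : x ∈ U) :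
    ∃ D : Fin 3 → Fin 3 → (Fin 3 → ℝ) →L[ℝ] ℝ,
      (∀ i j, HasFDerivAt (fun y => jacS ψ y i j) (D i j) x) ∧
      ∀ i j k, D i j (Pi.single k 1) = D i k (Pi.single j 1) := by
  have hc : ∀ i, ContDiffAt ℝ 2 (fun y => ψ y i) x := fun i =>
    contDiffAt_pi.1 (hψ.contDiffAt (hU.mem_nhds hx)) i
  have hd : ∀ i, DifferentiableAt ℝ (fderiv ℝ (fun y => ψ y i)) x := fun i =>
    ((hc i).fderiv_right (m := 1) (by norm_num)).differentiableAt (by norm_num)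
  refine ⟨fun i j => (fderiv ℝ (fderiv ℝ (fun y => ψ y i)) x).flip (Pi.single j 1), ?_, ?_⟩
  · intro i j
    have h := (hd i).hasFDerivAt.clm_apply (hasFDerivAt_const (Pi.single j (1:ℝ)) x)
    simpa [jacS] using h
  · intro i j k
    have h := (hc i).isSymmSndFDerivAt (by simp)
    exact h.eq _ _

/-- if moreover `J ≡ 1` on `U`, then `div_A X = div(Aᵀ X)`, i.e.
`∑_{i,j} A_{ij} ∂_j X_i = ∑_j ∂_j (∑_i A_{ij} X_i)`. -/
theorem divA_eq_div (U : Set (Fin 3 → ℝ)) (hU : IsOpen U)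
    (ψ : (Fin 3 → ℝ) → Fin 3 → ℝ) (hψ : ContDiffOn ℝ 2 ψ U)
    (hinv : ∀ x ∈ U, (jacS ψ x).det ≠ 0)
    (hJ : ∀ x ∈ U, (jacS ψ x).det = 1)
    (X : (Fin 3 → ℝ) → Fin 3 → ℝ) (hX : ContDiffOn ℝ 1 X U) :
    ∀ x ∈ U,
      (∑ i : Fin 3, ∑ j : Fin 3,
        ((jacS ψ x)⁻¹)ᵀ i j * fderiv ℝ (fun y => X y i) x (Pi.single j 1))
      = ∑ j : Fin 3,
          fderiv ℝ (fun y => ∑ i : Fin 3, ((jacS ψ y)⁻¹)ᵀ i j * X y i)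
            x (Pi.single j 1) := by
  intro x hx
  obtain ⟨D, hD, hS⟩ := jacS_hasFDerivAt U hU ψ hψ x hx
  have hXd : ∀ i, HasFDerivAt (fun y => X y i) (fderiv ℝ (fun y => X y i) x) x := fun i =>
    ((contDiffAt_pi.1 (hX.contDiffAt (hU.mem_nhds hx)) i).differentiableAt
      (by norm_num)).hasFDerivAt
  have hA : ∀ y ∈ U, (jacS ψ y)⁻¹ = (jacS ψ y).adjugate := by
    intro y hy
    rw [Matrix.inv_def, hJ y hy]; simp
  have hF : ∀ j, fderiv ℝ (fun y => ∑ i : Fin 3, ((jacS ψ y)⁻¹)ᵀ i j * X y i) x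
      = fderiv ℝ (fun y => ∑ i : Fin 3, ((jacS ψ y).adjugate)ᵀ i j * X y i) x := by
    intro j
    apply Filter.EventuallyEq.fderiv_eq
    filter_upwards [hU.mem_nhds hx] with y hy
    rw [hA y hy]
  have hcof : ∀ (M : Matrix (Fin 3) (Fin 3) ℝ) (i j : Fin 3), (M.adjugate)ᵀ i j =
      M (i+1) (j+1) * M (i+2) (j+2) - M (i+1) (j+2) * M (i+2) (j+1) := by
    intro M i j
    rw [Matrix.adjugate_fin_three]
    fin_cases i <;> fin_cases j <;> simp [Matrix.transpose_apply] <;> ring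
  have hB : ∀ i j, ∃ B : (Fin 3 → ℝ) →L[ℝ] ℝ,
      HasFDerivAt (fun y => ((jacS ψ y).adjugate)ᵀ i j) B x ∧ ∀ v, B v =
        jacS ψ x (i+1) (j+1) * D (i+2) (j+2) v + jacS ψ x (i+2) (j+2) * D (i+1) (j+1) v
        - (jacS ψ x (i+1) (j+2) * D (i+2) (j+1) v + jacS ψ x (i+2) (j+1) * D (i+1) (j+2) v) := by
    intro i j
    simp only [hcof]
    refine ⟨_, ((hD _ _).fun_mul (hD _ _)).fun_sub ((hD _ _).fun_mul (hD _ _)), fun v => ?_⟩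
    simp
  choose B hB hBv using hB
  have hG : ∀ j, fderiv ℝ (fun y => ∑ i : Fin 3, ((jacS ψ y)⁻¹)ᵀ i j * X y i) x (Pi.single j 1)
      = ∑ i : Fin 3, (((jacS ψ x).adjugate)ᵀ i j * fderiv ℝ (fun y => X y i) x (Pi.single j 1)
        + X x i * B i j (Pi.single j 1)) := by
    intro j
    rw [hF, (HasFDerivAt.fun_sum (fun i _ => (hB i j).fun_mul (hXd i))).fderiv]
    simp
  have hP : ∀ i, ∑ j, B i j (Pi.single j 1) = 0 := by
    intro i
    simp only [Fin.sum_univ_three, hBv, Fin.isValue, Fin.reduceAdd]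
    rw [hS _ 1 0, hS _ 2 0, hS _ 2 1]
    simp only [hS _ 1 0, hS _ 2 0, hS _ 2 1]
    ring
  simp only [hG]
  rw [Finset.sum_comm (f := fun j i => _ + _)]
  refine Finset.sum_congr rfl fun i _ => ?_
  rw [Finset.sum_add_distrib, ← Finset.mul_sum, hP, hA x hx]
  simp
end

section
/- Suppose B : ℝ × ℝ³ → ℝ³ is C¹ and satisfies the compressible Lagrangian magnetic equation ∂_t B − B·∇_A u + B · (div_A u) = 0, i.e. componentwise ∂_t B_i = ∑_{j,k} B_j A_{jk} ∂_k u_i − B_i · div_A u, where u = ∂_t η. Then ∂_t (J Aᵀ B) ≡ 0; componentwise, for each j, ∂_t ( J(t,x) ∑_i A_{ij}(t,x) B_i(t,x) ) = 0, and hence (J Aᵀ B)(t,x) = (J Aᵀ B)(0,x) for all (t,x). -/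
open Matrix

/-- The spatial Jacobian matrix `∇η(t,x)` of a time-dependent map
`η : ℝ × ℝ³ → ℝ³`, with entries `(∇η)_{ij} = ∂η_i/∂x_j`. -/
noncomputable def jacTD (η : ℝ × (Fin 3 → ℝ) → Fin 3 → ℝ) (t : ℝ) (x : Fin 3 → ℝ) :
    Matrix (Fin 3) (Fin 3) ℝ :=
  Matrix.of fun i j => fderiv ℝ (fun y => η (t, y) i) x (Pi.single j 1)

/-- The Jacobian determinant `J(t,x) = det ∇η(t,x)`. -/
noncomputable def Jdet (η : ℝ × (Fin 3 → ℝ) → Fin 3 → ℝ) (t : ℝ) (x : Fin 3 → ℝ) : ℝ :=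
  (jacTD η t x).det

/-- The matrix `A(t,x) = ((∇η(t,x))⁻¹)ᵀ`. -/
noncomputable def Amat (η : ℝ × (Fin 3 → ℝ) → Fin 3 → ℝ) (t : ℝ) (x : Fin 3 → ℝ) :
    Matrix (Fin 3) (Fin 3) ℝ :=
  ((jacTD η t x)⁻¹)ᵀ

/-- The Lagrangian velocity `u = ∂_t η`. -/
noncomputable def uvel (η : ℝ × (Fin 3 → ℝ) → Fin 3 → ℝ) (p : ℝ × (Fin 3 → ℝ)) :
    Fin 3 → ℝ :=
  fun i => deriv (fun s => η (s, p.2) i) p.1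

/-- `div_A X = ∑_{i,j} A_{ij} ∂_j X_i` for a time-dependent vector field `X`. -/
noncomputable def divA (η X : ℝ × (Fin 3 → ℝ) → Fin 3 → ℝ) (t : ℝ) (x : Fin 3 → ℝ) : ℝ :=
  ∑ i : Fin 3, ∑ j : Fin 3,
    Amat η t x i j * fderiv ℝ (fun y => X (t, y) i) x (Pi.single j 1)

/-- Mixed partials: the time derivative of `∂_k η_i` is `∂_k u_i`. -/
lemma hasDerivAt_jacTD (η : ℝ × (Fin 3 → ℝ) → Fin 3 → ℝ) (hη : ContDiff ℝ 2 η)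
    (t : ℝ) (x : Fin 3 → ℝ) (i k : Fin 3) :
    HasDerivAt (fun s => jacTD η s x i k)
      (fderiv ℝ (fun y => uvel η (t, y) i) x (Pi.single k 1)) t := by
  have hd : Differentiable ℝ η := hη.differentiable (by norm_num)
  have hd2 : Differentiable ℝ (fderiv ℝ η) :=
    (hη.fderiv_right (m := 1) (by norm_num)).differentiable (by norm_num)
  have pt : ∀ (s : ℝ) (y : Fin 3 → ℝ),
      HasFDerivAt (fun r : ℝ => (r, y)) (ContinuousLinearMap.inl ℝ ℝ (Fin 3 → ℝ)) s :=
    fun s y => hasFDerivAt_prodMk_left s y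
  have px : ∀ (s : ℝ) (y : Fin 3 → ℝ),
      HasFDerivAt (fun z : Fin 3 → ℝ => (s, z)) (ContinuousLinearMap.inr ℝ ℝ (Fin 3 → ℝ)) y :=
    fun s y => hasFDerivAt_prodMk_right s y
  have e1 : ∀ s, jacTD η s x i k = fderiv ℝ η (s, x) (0, Pi.single k 1) i := by
    intro s
    have h := (hasFDerivAt_pi'.1 ((hd (s, x)).hasFDerivAt.comp x (px s x))) i
    have h2 : fderiv ℝ (fun y => η (s, y) i) x = _ := h.fderiv
    simp [jacTD, h2]
  have e2 : ∀ y, uvel η (t, y) i = fderiv ℝ η (t, y) (1, 0) i := by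
    intro y
    have h := (hasFDerivAt_pi'.1 ((hd (t, y)).hasFDerivAt.comp t (pt t y))) i
    have h2 : deriv (fun s => η (s, y) i) t = _ := h.hasDerivAt.deriv
    simp [uvel, h2]
  have hsym : IsSymmSndFDerivAt ℝ η (t, x) :=
    hη.contDiffAt.isSymmSndFDerivAt (by simp)
  have key1 : HasDerivAt (fun s => fderiv ℝ η (s, x) (0, Pi.single k 1) i)
      (fderiv ℝ (fderiv ℝ η) (t, x) (1, 0) (0, Pi.single k 1) i) t := by
    have h := ((hd2 (t, x)).hasFDerivAt.comp t (pt t x)).clm_apply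
      (hasFDerivAt_const ((0 : ℝ), (Pi.single k 1 : Fin 3 → ℝ)) t)
    have h2 := ((hasFDerivAt_pi'.1 h) i).hasDerivAt
    simpa using h2
  have key2 : HasFDerivAt (fun y => fderiv ℝ η (t, y) (1, 0) i) _ x :=
    (hasFDerivAt_pi'.1 (((hd2 (t, x)).hasFDerivAt.comp x (px t x)).clm_apply
      (hasFDerivAt_const ((1 : ℝ), (0 : Fin 3 → ℝ)) x))) i
  simp only [e1, e2]
  rw [key2.fderiv]
  convert key1 using 1
  rw [hsym.eq]
  simp

/-- Cramer: the entries of `A` are those of the adjugate of `∇η` over `J`. -/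
lemma JAB_eq (η : ℝ × (Fin 3 → ℝ) → Fin 3 → ℝ) (t : ℝ) (x : Fin 3 → ℝ) (i j : Fin 3) :
    Amat η t x i j = (jacTD η t x).adjugate j i / (jacTD η t x).det := by
  simp [Amat, Matrix.inv_def, Ring.inverse_eq_inv', div_eq_inv_mul]

/-- if `B` solves the compressible Lagrangian magnetic equation
`∂_t B − B·∇_A u + B div_A u = 0`, then `∂_t (J Aᵀ B) ≡ 0` and `J Aᵀ B` is
conserved in time. -/
theorem magnetic_conservation_compressible
    (η : ℝ × (Fin 3 → ℝ) → Fin 3 → ℝ) (hη : ContDiff ℝ 2 η)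
    (hinv : ∀ (t : ℝ) (x : Fin 3 → ℝ), (jacTD η t x).det ≠ 0)
    (B : ℝ × (Fin 3 → ℝ) → Fin 3 → ℝ) (hB : ContDiff ℝ 1 B)
    (heq : ∀ (t : ℝ) (x : Fin 3 → ℝ) (i : Fin 3),
      deriv (fun s => B (s, x) i) t =
        (∑ j : Fin 3, ∑ k : Fin 3,
          B (t, x) j * Amat η t x j k *
            fderiv ℝ (fun y => uvel η (t, y) i) x (Pi.single k 1))
        - B (t, x) i * divA η (uvel η) t x) :
    (∀ (t : ℝ) (x : Fin 3 → ℝ) (j : Fin 3),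
      deriv (fun s => Jdet η s x * ∑ i : Fin 3, Amat η s x i j * B (s, x) i) t = 0) ∧
    (∀ (t : ℝ) (x : Fin 3 → ℝ) (j : Fin 3),
      Jdet η t x * ∑ i : Fin 3, Amat η t x i j * B (t, x) i =
        Jdet η 0 x * ∑ i : Fin 3, Amat η 0 x i j * B (0, x) i) := by
  have main : ∀ (t : ℝ) (x : Fin 3 → ℝ) (j : Fin 3),
      HasDerivAt (fun s => Jdet η s x * ∑ i : Fin 3, Amat η s x i j * B (s, x) i) 0 t := by
    intro t x j
    have e : (fun s => Jdet η s x * ∑ i : Fin 3, Amat η s x i j * B (s, x) i) =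
        fun s => ∑ i : Fin 3, (jacTD η s x).adjugate j i * B (s, x) i := by
      funext s
      rw [Finset.mul_sum]
      refine Finset.sum_congr rfl fun i _ => ?_
      rw [JAB_eq η s x, Jdet]
      have := hinv s x
      field_simp
    rw [e]
    have hM := fun i k => hasDerivAt_jacTD η hη t x i k
    have hBd : ∀ i, HasDerivAt (fun s => B (s, x) i) (deriv (fun s => B (s, x) i) t) t := by
      intro i
      have hd : Differentiable ℝ B := hB.differentiable (by norm_num)
      have : Differentiable ℝ (fun s => B (s, x) i) := by fun_prop
      exact (this t).hasDerivAt
    have hdet := hinv t x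
    have hq := heq t x
    simp only [divA, JAB_eq η t x] at hq
    generalize hN : (fun i k => fderiv ℝ (fun y => uvel η (t, y) i) x (Pi.single k 1)) = N
      at *
    have hN' : ∀ i k, fderiv ℝ (fun y => uvel η (t, y) i) x (Pi.single k 1) = N i k :=
      fun i k => congrFun (congrFun hN i) k
    simp only [hN'] at hM hq
    have hadj : ∀ a b c d : Fin 3 × Fin 3, HasDerivAt
        (fun s => jacTD η s x a.1 a.2 * jacTD η s x b.1 b.2
          - jacTD η s x c.1 c.2 * jacTD η s x d.1 d.2)
        ((N a.1 a.2 * jacTD η t x b.1 b.2 + jacTD η t x a.1 a.2 * N b.1 b.2)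
          - (N c.1 c.2 * jacTD η t x d.1 d.2 + jacTD η t x c.1 c.2 * N d.1 d.2)) t :=
      fun a b c d => ((hM _ _).mul (hM _ _)).sub ((hM _ _).mul (hM _ _))
    -- cyclic form of the cofactors
    have hcyc : ∀ (M : Matrix (Fin 3) (Fin 3) ℝ) (j i : Fin 3), M.adjugate j i =
        M (i+1) (j+1) * M (i+2) (j+2) - M (i+1) (j+2) * M (i+2) (j+1) := by
      intro M j i
      rw [Matrix.adjugate_fin_three]
      fin_cases j <;> fin_cases i <;> simp <;> ring
    have hsum := HasDerivAt.fun_sum (u := Finset.univ) fun i (_ : i ∈ Finset.univ) =>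
      (hadj (i+1, j+1) (i+2, j+2) (i+1, j+2) (i+2, j+1)).mul (hBd i)
    simp only [hcyc]
    refine hsum.congr_deriv ?_
    simp only [hq]
    simp only [hcyc]
    have hD := Matrix.det_fin_three (jacTD η t x)
    generalize (jacTD η t x).det = D at *
    generalize jacTD η t x = M at *
    generalize B (t, x) = b at *
    clear hsum hadj hcyc hBd hM hN hN' hq e
    fin_cases j <;> simp [Fin.sum_univ_three] <;> field_simp <;> rw [hD] <;> ring
  refine ⟨fun t x j => (main t x j).deriv, fun t x j => ?_⟩
  exact is_const_of_deriv_eq_zero (fun s => (main s x j).differentiableAt)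
    (fun s => (main s x j).deriv) t 0
end

section
/- Suppose η is C³, B : ℝ × ℝ³ → ℝ³ is C² and satisfies the compressible Lagrangian magnetic equation ∂_t B − B·∇_A u + B · (div_A u) = 0 with u = ∂_t η. Then ∂_t ( J · div_A B )(t,x) = 0 for every (t,x); i.e. the quantity J div_A B is conserved in time. -/
open Matrix

/-- Explicit 3×3 determinant with columns `a b c`. -/
def dt3 (a b c : Fin 3 → ℝ) : ℝ :=
  a 0 * (b 1 * c 2 - b 2 * c 1) - a 1 * (b 0 * c 2 - b 2 * c 0) + a 2 * (b 0 * c 1 - b 1 * c 0)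

/-- Partial derivative of `f` at `p` in direction `v`, componentwise. -/
noncomputable def dd (f : ℝ × (Fin 3 → ℝ) → Fin 3 → ℝ) (p v : ℝ × (Fin 3 → ℝ)) : Fin 3 → ℝ :=
  fun i => fderiv ℝ (fun q => f q i) p v

lemma fderiv_dt3 (a b c : ℝ × (Fin 3 → ℝ) → Fin 3 → ℝ) (p v : ℝ × (Fin 3 → ℝ))
    (ha : Differentiable ℝ a) (hb : Differentiable ℝ b) (hc : Differentiable ℝ c) :
    Differentiable ℝ (fun q => dt3 (a q) (b q) (c q)) ∧
    fderiv ℝ (fun q => dt3 (a q) (b q) (c q)) p v =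
      dt3 (dd a p v) (b p) (c p) + dt3 (a p) (dd b p v) (c p) + dt3 (a p) (b p) (dd c p v) := by
  have ha' : ∀ i q, HasFDerivAt (fun q => a q i) (fderiv ℝ (fun q => a q i) q) q := fun i q =>
    ((differentiable_pi.1 ha i) q).hasFDerivAt
  have hb' : ∀ i q, HasFDerivAt (fun q => b q i) (fderiv ℝ (fun q => b q i) q) q := fun i q =>
    ((differentiable_pi.1 hb i) q).hasFDerivAt
  have hc' : ∀ i q, HasFDerivAt (fun q => c q i) (fderiv ℝ (fun q => c q i) q) q := fun i q =>
    ((differentiable_pi.1 hc i) q).hasFDerivAt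
  have key := fun q => (((ha' 0 q).mul (((hb' 1 q).mul (hc' 2 q)).sub ((hb' 2 q).mul (hc' 1 q)))).sub
    ((ha' 1 q).mul (((hb' 0 q).mul (hc' 2 q)).sub ((hb' 2 q).mul (hc' 0 q))))).add
    ((ha' 2 q).mul (((hb' 0 q).mul (hc' 1 q)).sub ((hb' 1 q).mul (hc' 0 q))))
  refine ⟨fun q => (key q).differentiableAt, ?_⟩
  have h2 : fderiv ℝ (fun q => dt3 (a q) (b q) (c q)) p = _ := (key p).fderiv
  rw [h2]
  simp [dt3, dd]
  ring

lemma slice_x (f : ℝ × (Fin 3 → ℝ) → ℝ) (hf : Differentiable ℝ f) (t : ℝ) (x w : Fin 3 → ℝ) :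
    fderiv ℝ (fun y => f (t, y)) x w = fderiv ℝ f (t, x) (0, w) := by
  have h := (hf (t, x)).hasFDerivAt.comp x (hasFDerivAt_prodMk_right t x)
  have h2 : fderiv ℝ (fun y => f (t, y)) x = _ := h.fderiv
  rw [h2]; simp

lemma slice_t (f : ℝ × (Fin 3 → ℝ) → ℝ) (hf : Differentiable ℝ f) (t : ℝ) (x : Fin 3 → ℝ) :
    HasDerivAt (fun s => f (s, x)) (fderiv ℝ f (t, x) (1, 0)) t := by
  have h := ((hf (t, x)).hasFDerivAt.comp t (hasFDerivAt_prodMk_left t x)).hasDerivAt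
  have e : fderiv ℝ f (t, x) (1, 0) = (fderiv ℝ f (t, x) ∘L ContinuousLinearMap.inl ℝ ℝ (Fin 3 → ℝ)) 1 := by simp
  rw [e]
  exact h

lemma dd_contDiff (f : ℝ × (Fin 3 → ℝ) → Fin 3 → ℝ) (hf : ContDiff ℝ 3 f) (v : ℝ × (Fin 3 → ℝ)) :
    ContDiff ℝ 2 (fun p => dd f p v) := by
  rw [contDiff_pi]
  intro i
  exact ((contDiff_pi.1 hf i).fderiv_right (m := 2) (by norm_num)).clm_apply contDiff_const

lemma dd_symm (f : ℝ × (Fin 3 → ℝ) → Fin 3 → ℝ) (hf : ContDiff ℝ 3 f)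
    (p v w : ℝ × (Fin 3 → ℝ)) :
    dd (fun q => dd f q v) p w = dd (fun q => dd f q w) p v := by
  funext i
  have hi := contDiff_pi.1 hf i
  have hd : Differentiable ℝ (fderiv ℝ (fun q => f q i)) :=
    (hi.fderiv_right (m := 2) (by norm_num)).differentiable (by norm_num)
  have hs : IsSymmSndFDerivAt ℝ (fun q => f q i) p :=
    hi.contDiffAt.isSymmSndFDerivAt (by simp only [minSmoothness_of_isRCLikeNormedField]; norm_num)
  have e : ∀ v w, fderiv ℝ (fun q => fderiv ℝ (fun q => f q i) q v) p w =
      fderiv ℝ (fderiv ℝ (fun q => f q i)) p w v := by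
    intro v w
    rw [fderiv_clm_apply (hd p) (differentiableAt_const v)]
    simp
  simp only [dd]
  rw [e, e]
  exact hs w v

/-- spatial direction -/
def ee (j : Fin 3) : ℝ × (Fin 3 → ℝ) := (0, Pi.single j 1)

lemma alg_time (F G : Fin 3 → Fin 3 → ℝ) (B B' c : Fin 3 → ℝ) (τ J : ℝ)
    (hJ : J = dt3 (F 0) (F 1) (F 2))
    (hτ : J * τ = dt3 (G 0) (F 1) (F 2) + dt3 (F 0) (G 1) (F 2) + dt3 (F 0) (F 1) (G 2))
    (hB : ∀ i, B i = ∑ k, c k * F k i)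
    (hB' : ∀ i, B' i = ∑ k, c k * G k i - B i * τ) :
    dt3 B' (F 1) (F 2) + dt3 B (G 1) (F 2) + dt3 B (F 1) (G 2) = 0 ∧
    dt3 (G 0) B (F 2) + dt3 (F 0) B' (F 2) + dt3 (F 0) B (G 2) = 0 ∧
    dt3 (G 0) (F 1) B + dt3 (F 0) (G 1) B + dt3 (F 0) (F 1) B' = 0 := by
  subst hJ
  simp only [dt3, hB', hB, Fin.sum_univ_three] at hτ ⊢
  refine ⟨?_, ?_, ?_⟩
  · linear_combination (-c 0) * hτ
  · linear_combination (-c 1) * hτ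
  · linear_combination (-c 2) * hτ

/-- if `η` is C³, `B` is C² and solves the compressible Lagrangian
magnetic equation `∂_t B − B·∇_A u + B div_A u = 0`, then `J div_A B` is
conserved in time: `∂_t (J div_A B) ≡ 0`. -/
theorem divA_magnetic_conserved
    (η : ℝ × (Fin 3 → ℝ) → Fin 3 → ℝ) (hη : ContDiff ℝ 3 η)
    (hinv : ∀ (t : ℝ) (x : Fin 3 → ℝ), (jacTD η t x).det ≠ 0)
    (B : ℝ × (Fin 3 → ℝ) → Fin 3 → ℝ) (hB : ContDiff ℝ 2 B)
    (heq : ∀ (t : ℝ) (x : Fin 3 → ℝ) (i : Fin 3),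
      deriv (fun s => B (s, x) i) t =
        (∑ j : Fin 3, ∑ k : Fin 3,
          B (t, x) j * Amat η t x j k *
            fderiv ℝ (fun y => uvel η (t, y) i) x (Pi.single k 1))
        - B (t, x) i * divA η (uvel η) t x) :
    ∀ (t : ℝ) (x : Fin 3 → ℝ),
      deriv (fun s => Jdet η s x * divA η B s x) t = 0 := by
  intro t x
  have hηd : ∀ i, Differentiable ℝ (fun q => η q i) := fun i =>
    (contDiff_pi.1 hη i).differentiable (by norm_num)
  have hBd : Differentiable ℝ B := hB.differentiable (by norm_num)
  have hBdi : ∀ i, Differentiable ℝ (fun q => B q i) := differentiable_pi.1 hBd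
  have hu : uvel η = fun p => dd η p (1, 0) := by
    funext p i
    exact (slice_t _ (hηd i) p.1 p.2).deriv
  have hjac : ∀ t x i j, jacTD η t x i j = dd η (t, x) (ee j) i := by
    intro t x i j
    exact slice_x _ (hηd i) t x _
  set F : Fin 3 → ℝ × (Fin 3 → ℝ) → Fin 3 → ℝ := fun j p => dd η p (ee j) with hF
  have hFd : ∀ j, Differentiable ℝ (F j) := fun j =>
    (dd_contDiff η hη (ee j)).differentiable (by norm_num)
  have hud : Differentiable ℝ (fun p => dd η p (1, 0)) :=
    (dd_contDiff η hη (1, 0)).differentiable (by norm_num)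
  have hux : ∀ t x i k, fderiv ℝ (fun y => uvel η (t, y) i) x (Pi.single k 1)
      = dd (F k) (t, x) (1, 0) i := by
    intro t x i k
    rw [hu, hF, dd_symm η hη]
    exact slice_x _ (differentiable_pi.1 hud i) t x _
  have hJ : ∀ t x, (jacTD η t x).det = dt3 (F 0 (t, x)) (F 1 (t, x)) (F 2 (t, x)) := by
    intro t x
    rw [Matrix.det_fin_three]
    simp only [hjac, dt3, hF]
    ring
  -- J div_A X
  have hdiv : ∀ t x (D : Fin 3 → Fin 3 → ℝ),
      (jacTD η t x).det * ∑ i, ∑ j, Amat η t x i j * D j i =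
      dt3 (D 0) (F 1 (t, x)) (F 2 (t, x)) + dt3 (F 0 (t, x)) (D 1) (F 2 (t, x))
        + dt3 (F 0 (t, x)) (F 1 (t, x)) (D 2) := by
    intro t x D
    have hA : ∀ i j, Amat η t x i j
        = ((jacTD η t x).det)⁻¹ * (jacTD η t x).adjugate j i := by
      intro i j
      simp [Amat, Matrix.inv_def]
    have : (jacTD η t x).det * ∑ i, ∑ j, Amat η t x i j * D j i
        = ∑ i, ∑ j, (jacTD η t x).adjugate j i * D j i := by
      simp only [Finset.mul_sum, hA]
      refine Finset.sum_congr rfl fun i _ => Finset.sum_congr rfl fun j _ => ?_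
      have := hinv t x
      field_simp
    rw [this, Matrix.adjugate_fin_three]
    simp [Fin.sum_univ_three, hjac, dt3, hF]
    ring
  let b0 := fun q => dt3 (B q) (F 1 q) (F 2 q)
  let b1 := fun q => dt3 (F 0 q) (B q) (F 2 q)
  let b2 := fun q => dt3 (F 0 q) (F 1 q) (B q)
  have d0 := fun p v => fderiv_dt3 B (F 1) (F 2) p v hBd (hFd 1) (hFd 2)
  have d1 := fun p v => fderiv_dt3 (F 0) B (F 2) p v (hFd 0) hBd (hFd 2)
  have d2 := fun p v => fderiv_dt3 (F 0) (F 1) B p v (hFd 0) (hFd 1) hBd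
  have D0 : Differentiable ℝ b0 := (d0 0 0).1
  have D1 : Differentiable ℝ b1 := (d1 0 0).1
  have D2 : Differentiable ℝ b2 := (d2 0 0).1
  have htime : ∀ t x, fderiv ℝ b0 (t, x) (1, 0) = 0 ∧ fderiv ℝ b1 (t, x) (1, 0) = 0 ∧
      fderiv ℝ b2 (t, x) (1, 0) = 0 := by
    intro t x
    rw [(d0 (t, x) (1, 0)).2, (d1 (t, x) (1, 0)).2, (d2 (t, x) (1, 0)).2]
    refine alg_time (fun j => F j (t, x)) (fun j => dd (F j) (t, x) (1, 0)) (B (t, x))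
      (dd B (t, x) (1, 0)) (fun k => ∑ j, B (t, x) j * Amat η t x j k)
      (divA η (uvel η) t x) (jacTD η t x).det (hJ t x) ?_ ?_ ?_
    · simp only [divA, hux]
      exact hdiv t x (fun j => dd (F j) (t, x) (1, 0))
    · intro i
      have h1 : (jacTD η t x) *ᵥ ((jacTD η t x)⁻¹ *ᵥ B (t, x)) = B (t, x) := by
        rw [Matrix.mulVec_mulVec, Matrix.mul_nonsing_inv _ (isUnit_iff_ne_zero.2 (hinv t x)),
          Matrix.one_mulVec]
      have h2 := congrFun h1 i
      simp only [Matrix.mulVec, dotProduct, hjac] at h2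
      rw [← h2]
      refine Finset.sum_congr rfl fun k _ => ?_
      rw [mul_comm]
      congr 1
      refine Finset.sum_congr rfl fun j _ => ?_
      simp [Amat, mul_comm]
    · intro i
      have h1 := heq t x i
      rw [(slice_t _ (hBdi i) t x).deriv] at h1
      simp only [hux] at h1
      refine h1.trans ?_
      congr 1
      rw [Finset.sum_comm]
      simp only [Finset.sum_mul]
  have hconst : ∀ b : ℝ × (Fin 3 → ℝ) → ℝ, Differentiable ℝ b →
      (∀ t x, fderiv ℝ b (t, x) (1, 0) = 0) → ∀ t x w,
      fderiv ℝ b (t, x) (0, w) = fderiv ℝ b (0, x) (0, w) := by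
    intro b hb h t x w
    rw [← slice_x b hb, ← slice_x b hb]
    have : (fun y => b (t, y)) = fun y => b (0, y) := by
      funext y
      exact is_const_of_deriv_eq_zero (f := fun s => b (s, y))
        (fun s => (slice_t b hb s y).differentiableAt)
        (fun s => (slice_t b hb s y).deriv.trans (h s y)) t 0
    rw [this]
  have hmain : ∀ s, Jdet η s x * divA η B s x =
      fderiv ℝ b0 (s, x) (ee 0) + fderiv ℝ b1 (s, x) (ee 1) + fderiv ℝ b2 (s, x) (ee 2) := by
    intro s
    have hBx : ∀ i k, fderiv ℝ (fun y => B (s, y) i) x (Pi.single k 1)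
        = dd B (s, x) (ee k) i := fun i k => slice_x _ (hBdi i) s x _
    simp only [divA, hBx, Jdet]
    rw [hdiv s x (fun j => dd B (s, x) (ee j)), (d0 (s, x) (ee 0)).2, (d1 (s, x) (ee 1)).2,
      (d2 (s, x) (ee 2)).2]
    have s1 : dd (F 1) (s, x) (ee 0) = dd (F 0) (s, x) (ee 1) := dd_symm η hη _ _ _
    have s2 : dd (F 2) (s, x) (ee 0) = dd (F 0) (s, x) (ee 2) := dd_symm η hη _ _ _
    have s3 : dd (F 2) (s, x) (ee 1) = dd (F 1) (s, x) (ee 2) := dd_symm η hη _ _ _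
    rw [s1, s2, s3]
    simp only [dt3]
    ring
  have hfin : (fun s => Jdet η s x * divA η B s x) = fun _ =>
      fderiv ℝ b0 (0, x) (ee 0) + fderiv ℝ b1 (0, x) (ee 1) + fderiv ℝ b2 (0, x) (ee 2) := by
    funext s
    rw [hmain s]
    simp only [ee]
    rw [hconst b0 D0 (fun t x => (htime t x).1) s x, hconst b1 D1 (fun t x => (htime t x).2.1) s x,
      hconst b2 D2 (fun t x => (htime t x).2.2) s x]
  rw [hfin]
  simp
end

section
/- Suppose B : ℝ × ℝ³ → ℝ³ is C¹ and satisfies the compressible Lagrangian magnetic equation ∂_t B − B·∇_A u + B · (div_A u) = 0 with u = ∂_t η, and that B(0,x) = J(0,x)⁻¹ ∇η(0,x) B̄ for some constant vector B̄ ∈ ℝ³ and all x. Then B(t,x) = J(t,x)⁻¹ ∇η(t,x) B̄ for all (t,x) ∈ ℝ × ℝ³. -/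
open Matrix

lemma adj_mulVec_hasDerivAt (M : ℝ → Matrix (Fin 3) (Fin 3) ℝ) (N : Matrix (Fin 3) (Fin 3) ℝ)
    (b : ℝ → Fin 3 → ℝ) (b' : Fin 3 → ℝ) (t : ℝ)
    (hM : ∀ i j, HasDerivAt (fun s => M s i j) (N i j) t)
    (hb : ∀ i, HasDerivAt (fun s => b s i) (b' i) t)
    (hdet : (M t).det ≠ 0)
    (hb' : ∀ i, (M t).det * b' i =
      (∑ j : Fin 3, ∑ k : Fin 3, b t j * (M t).adjugate k j * N i k)
        - b t i * ∑ i : Fin 3, ∑ j : Fin 3, (M t).adjugate j i * N i j) (i : Fin 3) :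
    HasDerivAt (fun s => ((M s).adjugate.mulVec (b s)) i) 0 t := by
  have h0 := hb' 0
  have h1 := hb' 1
  have h2 := hb' 2
  simp only [Fin.sum_univ_three, adjugate_fin_three, det_fin_three, of_apply, cons_val] at h0 h1 h2
  have h : ∃ D, HasDerivAt (fun s => ((M s).adjugate.mulVec (b s)) i) D t ∧ (M t).det * D = 0 := by
    fin_cases i <;>
    simp only [mulVec, dotProduct, Fin.sum_univ_three, adjugate_fin_three, of_apply, cons_val,
      Fin.zero_eta, Fin.mk_one, Fin.reduceFinMk]
    · refine ⟨_, (((((hM 1 1).mul (hM 2 2)).sub ((hM 1 2).mul (hM 2 1))).mul (hb 0)).add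
        ((((hM 0 1).mul (hM 2 2)).neg.add ((hM 0 2).mul (hM 2 1))).mul (hb 1))).add
        ((((hM 0 1).mul (hM 1 2)).sub ((hM 0 2).mul (hM 1 1))).mul (hb 2)) |>.congr_of_eventuallyEq
        (Filter.Eventually.of_forall fun s => ?_), ?_⟩
      · simp only [Pi.add_apply, Pi.mul_apply, Pi.sub_apply, Pi.neg_apply]
        try ring
      · simp only [Pi.add_apply, Pi.mul_apply, Pi.sub_apply, Pi.neg_apply, det_fin_three]
        linear_combination (M t 1 1 * M t 2 2 - M t 1 2 * M t 2 1) * h0 +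
          (-(M t 0 1 * M t 2 2) + M t 0 2 * M t 2 1) * h1 +
          (M t 0 1 * M t 1 2 - M t 0 2 * M t 1 1) * h2
    · refine ⟨_, (((((hM 1 0).mul (hM 2 2)).neg.add ((hM 1 2).mul (hM 2 0))).mul (hb 0)).add
        ((((hM 0 0).mul (hM 2 2)).sub ((hM 0 2).mul (hM 2 0))).mul (hb 1))).add
        ((((hM 0 0).mul (hM 1 2)).neg.add ((hM 0 2).mul (hM 1 0))).mul (hb 2)) |>.congr_of_eventuallyEq
        (Filter.Eventually.of_forall fun s => ?_), ?_⟩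
      · simp only [Pi.add_apply, Pi.mul_apply, Pi.sub_apply, Pi.neg_apply]
        try ring
      · simp only [Pi.add_apply, Pi.mul_apply, Pi.sub_apply, Pi.neg_apply, det_fin_three]
        linear_combination (-(M t 1 0 * M t 2 2) + M t 1 2 * M t 2 0) * h0 +
          (M t 0 0 * M t 2 2 - M t 0 2 * M t 2 0) * h1 +
          (-(M t 0 0 * M t 1 2) + M t 0 2 * M t 1 0) * h2
    · refine ⟨_, (((((hM 1 0).mul (hM 2 1)).sub ((hM 1 1).mul (hM 2 0))).mul (hb 0)).add
        ((((hM 0 0).mul (hM 2 1)).neg.add ((hM 0 1).mul (hM 2 0))).mul (hb 1))).add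
        ((((hM 0 0).mul (hM 1 1)).sub ((hM 0 1).mul (hM 1 0))).mul (hb 2)) |>.congr_of_eventuallyEq
        (Filter.Eventually.of_forall fun s => ?_), ?_⟩
      · simp only [Pi.add_apply, Pi.mul_apply, Pi.sub_apply, Pi.neg_apply]
        try ring
      · simp only [Pi.add_apply, Pi.mul_apply, Pi.sub_apply, Pi.neg_apply, det_fin_three]
        linear_combination (M t 1 0 * M t 2 1 - M t 1 1 * M t 2 0) * h0 +
          (-(M t 0 0 * M t 2 1) + M t 0 1 * M t 2 0) * h1 +
          (M t 0 0 * M t 1 1 - M t 0 1 * M t 1 0) * h2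
  obtain ⟨D, hD, hD0⟩ := h
  rwa [(mul_eq_zero.1 hD0).resolve_left hdet] at hD

/-- The spatial derivative of a slice in terms of the full derivative. -/
lemma slice_fderiv (f : ℝ × (Fin 3 → ℝ) → ℝ) (t : ℝ) (x v : Fin 3 → ℝ)
    (hf : DifferentiableAt ℝ f (t, x)) :
    fderiv ℝ (fun y => f (t, y)) x v = fderiv ℝ f (t, x) (0, v) := by
  have h := hf.hasFDerivAt.comp x (hasFDerivAt_prodMk_right t x)
  have h2 : fderiv ℝ (fun y => f (t, y)) x = _ := h.fderiv
  rw [h2]; simp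

lemma slice_hasDerivAt (f : ℝ × (Fin 3 → ℝ) → ℝ) (t : ℝ) (x : Fin 3 → ℝ)
    (hf : DifferentiableAt ℝ f (t, x)) :
    HasDerivAt (fun s => f (s, x)) (fderiv ℝ f (t, x) (1, 0)) t := by
  have h := (hf.hasFDerivAt.comp t (hasFDerivAt_prodMk_left t x)).hasDerivAt
  have e : (fderiv ℝ f (t, x) ∘L ContinuousLinearMap.inl ℝ ℝ (Fin 3 → ℝ)) 1
      = fderiv ℝ f (t, x) (1, 0) := by simp
  rw [← e]
  exact h

/-- The time derivative of the Jacobian is the spatial derivative of the velocity. -/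
lemma jac_hasDerivAt (η : ℝ × (Fin 3 → ℝ) → Fin 3 → ℝ) (hη : ContDiff ℝ 2 η)
    (t : ℝ) (x : Fin 3 → ℝ) (i j : Fin 3) :
    HasDerivAt (fun s => jacTD η s x i j)
      (fderiv ℝ (fun y => uvel η (t, y) i) x (Pi.single j 1)) t := by
  have hf : ContDiff ℝ 2 (fun p => η p i) := contDiff_pi.1 hη i
  set f := fun p => η p i with hfdef
  have hfd : Differentiable ℝ f := hf.differentiable (by norm_num)
  have hf' : Differentiable ℝ (fderiv ℝ f) :=
    (hf.fderiv_right (m := 1) (by norm_num)).differentiable (by norm_num)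
  have h1 : (fun s => jacTD η s x i j) = fun s => fderiv ℝ f (s, x) (0, Pi.single j 1) := by
    funext s
    exact slice_fderiv f s x _ (hfd _)
  have h2 : (fun y => uvel η (t, y) i) = fun y => fderiv ℝ f (t, y) (1, 0) := by
    funext y
    exact (slice_hasDerivAt f t y (hfd _)).deriv
  have hsym : IsSymmSndFDerivAt ℝ f (t, x) :=
    hf.contDiffAt.isSymmSndFDerivAt (by simp)
  have hc : ∀ v w, fderiv ℝ (fun p => fderiv ℝ f p v) (t, x) w
      = fderiv ℝ (fderiv ℝ f) (t, x) w v := by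
    intro v w
    rw [fderiv_clm_apply (hf' _) (differentiableAt_const v)]
    simp
  have hd : ∀ v, DifferentiableAt ℝ (fun p => fderiv ℝ f p v) (t, x) := fun v =>
    (hf' _).clm_apply (differentiableAt_const v)
  rw [h1, h2, slice_fderiv (fun p => fderiv ℝ f p (1, 0)) t x _ (hd _), hc, hsym, ← hc]
  exact slice_hasDerivAt (fun p => fderiv ℝ f p (0, Pi.single j 1)) t x (hd _)

/-- if `B` solves the compressible Lagrangian magnetic equation and
initially `B(0,·) = J(0,·)⁻¹ ∇η(0,·) B̄`, then `B(t,·) = J(t,·)⁻¹ ∇η(t,·) B̄`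
for all times. -/
theorem magnetic_field_formula_compressible
    (η : ℝ × (Fin 3 → ℝ) → Fin 3 → ℝ) (hη : ContDiff ℝ 2 η)
    (hinv : ∀ (t : ℝ) (x : Fin 3 → ℝ), (jacTD η t x).det ≠ 0)
    (B : ℝ × (Fin 3 → ℝ) → Fin 3 → ℝ) (hB : ContDiff ℝ 1 B)
    (heq : ∀ (t : ℝ) (x : Fin 3 → ℝ) (i : Fin 3),
      deriv (fun s => B (s, x) i) t =
        (∑ j : Fin 3, ∑ k : Fin 3,
          B (t, x) j * Amat η t x j k *
            fderiv ℝ (fun y => uvel η (t, y) i) x (Pi.single k 1))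
        - B (t, x) i * divA η (uvel η) t x)
    (Bbar : Fin 3 → ℝ)
    (hB0 : ∀ x : Fin 3 → ℝ, B (0, x) = (Jdet η 0 x)⁻¹ • (jacTD η 0 x).mulVec Bbar) :
    ∀ (t : ℝ) (x : Fin 3 → ℝ),
      B (t, x) = (Jdet η t x)⁻¹ • (jacTD η t x).mulVec Bbar := by
  intro t x
  have hder : ∀ (i : Fin 3) (t : ℝ),
      HasDerivAt (fun s => ((jacTD η s x).adjugate.mulVec (B (s, x))) i) 0 t := by
    intro i t
    have hA : ∀ j k, (jacTD η t x).det * Amat η t x j k = (jacTD η t x).adjugate k j := by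
      intro j k
      have := hinv t x
      simp only [Amat, transpose_apply, inv_def, Matrix.smul_apply, smul_eq_mul, Ring.inverse_eq_inv']
      field_simp
    refine adj_mulVec_hasDerivAt (fun s => jacTD η s x)
      (Matrix.of fun i j => fderiv ℝ (fun y => uvel η (t, y) i) x (Pi.single j 1))
      (fun s => B (s, x)) (fun i => deriv (fun s => B (s, x) i) t) t
      (fun i j => jac_hasDerivAt η hη t x i j) (fun i => ?_) (hinv t x) (fun i => ?_) i
    · have hBi : ContDiff ℝ 1 (fun p => B p i) := contDiff_pi.1 hB i
      exact (slice_hasDerivAt (fun p => B p i) t x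
        (hBi.differentiable (by norm_num) _)).differentiableAt.hasDerivAt
    · simp only [heq, divA, ← hA, of_apply, mul_sub, Finset.mul_sum]
      congr 1
      · refine Finset.sum_congr rfl fun j _ => Finset.sum_congr rfl fun k _ => ?_
        ring
      · refine Finset.sum_congr rfl fun j _ => Finset.sum_congr rfl fun k _ => ?_
        ring
  have hconst : (jacTD η t x).adjugate.mulVec (B (t, x)) = Bbar := by
    have h0 : (jacTD η 0 x).adjugate.mulVec (B (0, x)) = Bbar := by
      rw [hB0, mulVec_smul, mulVec_mulVec, adjugate_mul, smul_mulVec, one_mulVec, smul_smul, Jdet,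
        inv_mul_cancel₀ (hinv 0 x), one_smul]
    rw [← h0]
    funext i
    exact is_const_of_deriv_eq_zero (fun s => (hder i s).differentiableAt)
      (fun s => (hder i s).deriv) t 0
  rw [← hconst, mulVec_mulVec, mul_adjugate, smul_mulVec, one_mulVec, smul_smul, Jdet,
    inv_mul_cancel₀ (hinv t x), one_smul]
end

section
/- Let c > 0 and s > 0, and let f : [0,∞) → ℝ be differentiable with f(t) ≥ 0 and f'(t) + c f(t)^{1+s} ≤ 0 for all t ≥ 0. Then f(t) ≤ f(0) / (1 + s c f(0)^s t)^{1/s} for all t ≥ 0. -/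
/-- if `f ≥ 0` is differentiable on `[0,∞)` and satisfies
`f' + c f^{1+s} ≤ 0` with `c, s > 0`, then
`f(t) ≤ f(0) / (1 + s c f(0)^s t)^{1/s}` for all `t ≥ 0`. -/
theorem algebraic_decay (c s : ℝ) (hc : 0 < c) (hs : 0 < s)
    (f f' : ℝ → ℝ)
    (hderiv : ∀ t : ℝ, 0 ≤ t → HasDerivWithinAt f (f' t) (Set.Ici 0) t)
    (hnonneg : ∀ t : ℝ, 0 ≤ t → 0 ≤ f t)
    (hineq : ∀ t : ℝ, 0 ≤ t → f' t + c * f t ^ (1 + s) ≤ 0) :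
    ∀ t : ℝ, 0 ≤ t → f t ≤ f 0 / (1 + s * c * f 0 ^ s * t) ^ (1 / s) := by
  have hanti : AntitoneOn f (Set.Ici 0) := by
    refine antitoneOn_of_hasDerivWithinAt_nonpos (f' := f') (convex_Ici 0)
      (fun x hx => (hderiv x hx).continuousWithinAt) ?_ ?_
    · intro x hx
      exact (hderiv x (interior_subset hx)).mono interior_subset
    · intro x hx
      have hx0 : 0 ≤ x := interior_subset hx
      have h1 := hineq x hx0
      have h2 : 0 ≤ c * f x ^ (1 + s) :=
        mul_nonneg hc.le (Real.rpow_nonneg (hnonneg x hx0) _)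
      linarith
  intro t ht
  have hf0 := hnonneg 0 le_rfl
  have hA : 0 < 1 + s * c * f 0 ^ s * t := by
    have := Real.rpow_nonneg hf0 s
    positivity
  rcases (hnonneg t ht).eq_or_lt with h0 | hpos
  · rw [← h0]
    exact div_nonneg hf0 (Real.rpow_nonneg hA.le _)
  have hfp : ∀ x ∈ Set.Icc 0 t, 0 < f x := fun x hx =>
    hpos.trans_le (hanti hx.1 ht hx.2)
  have hsub : Set.Icc 0 t ⊆ Set.Ici (0 : ℝ) := fun x hx => hx.1
  have hd : ∀ x ∈ Set.Icc 0 t, HasDerivWithinAt (fun x => s * c * x - f x ^ (-s))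
      (s * c * 1 - f' x * (-s) * f x ^ (-s - 1)) (Set.Icc 0 t) x := by
    intro x hx
    exact ((hasDerivWithinAt_id x _).const_mul (s * c)).sub
      (((hderiv x hx.1).mono hsub).rpow_const (Or.inl (hfp x hx).ne'))
  have hg : AntitoneOn (fun x => s * c * x - f x ^ (-s)) (Set.Icc 0 t) := by
    refine antitoneOn_of_hasDerivWithinAt_nonpos
      (f' := fun x => s * c * 1 - f' x * (-s) * f x ^ (-s - 1)) (convex_Icc 0 t)
      (fun x hx => (hd x hx).continuousWithinAt) ?_ ?_
    · intro x hx
      exact (hd x (interior_subset hx)).mono interior_subset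
    · intro x hx
      have hx' : x ∈ Set.Icc 0 t := interior_subset hx
      have hp := hfp x hx'
      have h1 := hineq x hx'.1
      have h2 : f x ^ (1 + s) * f x ^ (-s - 1) = 1 := by
        rw [← Real.rpow_add hp]
        rw [show 1 + s + (-s - 1) = 0 by ring, Real.rpow_zero]
      have h3 : 0 < s * f x ^ (-s - 1) := mul_pos hs (Real.rpow_pos_of_pos hp _)
      have h4 := mul_nonpos_of_nonneg_of_nonpos h3.le h1
      have h5 : s * f x ^ (-s - 1) * (f' x + c * f x ^ (1 + s))
          = s * f x ^ (-s - 1) * f' x + s * c * (f x ^ (1 + s) * f x ^ (-s - 1)) := by ring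
      rw [h5, h2] at h4
      change s * c * 1 - f' x * (-s) * f x ^ (-s - 1) ≤ 0
      linarith
  have h := hg (Set.left_mem_Icc.2 ht) (Set.right_mem_Icc.2 ht) ht
  have hp0 := hfp 0 (Set.left_mem_Icc.2 ht)
  simp only [Real.rpow_neg hf0, Real.rpow_neg hpos.le] at h
  have ha : 0 < f 0 ^ s := Real.rpow_pos_of_pos hp0 _
  have hb : 0 < f t ^ s := Real.rpow_pos_of_pos hpos _
  have key : f t ^ s * (1 + s * c * f 0 ^ s * t) ≤ f 0 ^ s := by
    have h6 : (f 0 ^ s)⁻¹ + s * c * t ≤ (f t ^ s)⁻¹ := by linarith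
    have h7 := mul_le_mul_of_nonneg_left h6 (mul_pos ha hb).le
    have h8 : f 0 ^ s * f t ^ s * ((f 0 ^ s)⁻¹ + s * c * t)
        = f t ^ s * (1 + s * c * f 0 ^ s * t) := by
      field_simp
    have h9 : f 0 ^ s * f t ^ s * (f t ^ s)⁻¹ = f 0 ^ s := by
      field_simp
    rwa [h8, h9] at h7
  rw [le_div_iff₀ (Real.rpow_pos_of_pos hA _)]
  have h10 := Real.rpow_le_rpow (mul_pos hb hA).le key (one_div_pos.2 hs).le
  rwa [Real.mul_rpow hb.le hA.le, ← Real.rpow_mul hpos.le, ← Real.rpow_mul hf0,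
    mul_one_div_cancel hs.ne', Real.rpow_one, Real.rpow_one] at h10
end

section
/- Let θ ∈ (0,1), M > 0, and let f : [0,∞) → [0,∞) be differentiable and g : [0,∞) → [0,∞) satisfy f'(t) + g(t) ≤ 0 and f(t) ≤ M^{1−θ} (g(t))^{θ} for all t ≥ 0, and assume f(0) ≤ M. Set s = (1−θ)/θ. Then f(t) ≤ M / (1 + s t)^{1/s} for all t ≥ 0. -/
/-- abstract two-tier decay scheme.  If `f' + g ≤ 0`,
`f ≤ M^{1−θ} g^θ` on `[0,∞)` and `f(0) ≤ M`, then with `s = (1−θ)/θ` one has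
`f(t) ≤ M / (1 + s t)^{1/s}` for all `t ≥ 0`. -/
theorem interpolation_decay (θ M : ℝ) (hθ0 : 0 < θ) (hθ1 : θ < 1) (hM : 0 < M)
    (f f' g : ℝ → ℝ)
    (hderiv : ∀ t : ℝ, 0 ≤ t → HasDerivWithinAt f (f' t) (Set.Ici 0) t)
    (hf : ∀ t : ℝ, 0 ≤ t → 0 ≤ f t)
    (hg : ∀ t : ℝ, 0 ≤ t → 0 ≤ g t)
    (hineq : ∀ t : ℝ, 0 ≤ t → f' t + g t ≤ 0)
    (hinterp : ∀ t : ℝ, 0 ≤ t → f t ≤ M ^ (1 - θ) * g t ^ θ)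
    (h0 : f 0 ≤ M) :
    ∀ t : ℝ, 0 ≤ t →
      f t ≤ M / (1 + ((1 - θ) / θ) * t) ^ (1 / ((1 - θ) / θ)) := by
  intro T hT
  obtain ⟨s, hs⟩ : ∃ s, s = (1 - θ) / θ := ⟨_, rfl⟩
  have hs0 : 0 < s := by rw [hs]; exact div_pos (by linarith) hθ0
  rw [← hs]
  have hbase : 0 < 1 + s * T := by positivity
  rcases (hf T hT).eq_or_lt with hz | hpos
  · rw [← hz]; positivity
  have hd : ∀ t, 0 < t → HasDerivAt f (f' t) t := fun t ht =>
    (hderiv t ht.le).hasDerivAt (Ici_mem_nhds ht)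
  have hcont : ContinuousOn f (Set.Ici 0) := fun t ht => (hderiv t ht).continuousWithinAt
  have hanti : AntitoneOn f (Set.Ici 0) := by
    apply antitoneOn_of_deriv_nonpos (convex_Ici 0) hcont
    · intro t ht
      rw [interior_Ici] at ht
      exact (hd t ht).differentiableAt.differentiableWithinAt
    · intro t ht
      rw [interior_Ici] at ht
      rw [(hd t ht).deriv]
      have h1 := hineq t (le_of_lt ht)
      have h2 := hg t (le_of_lt ht)
      linarith
  have hfp : ∀ t ∈ Set.Icc 0 T, 0 < f t := fun t ht =>
    lt_of_lt_of_le hpos (hanti ht.1 hT ht.2)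
  have hkey : ∀ t ∈ Set.Icc 0 T, f t ^ (s + 1) ≤ M ^ s * g t := by
    intro t ht
    have hg0 := hg t ht.1
    have h1 : f t ^ (1 / θ) ≤ (M ^ (1 - θ) * g t ^ θ) ^ (1 / θ) :=
      Real.rpow_le_rpow (hf t ht.1) (hinterp t ht.1) (by positivity)
    rw [Real.mul_rpow (by positivity) (by positivity), ← Real.rpow_mul hM.le,
      ← Real.rpow_mul hg0, mul_one_div_cancel hθ0.ne', Real.rpow_one, mul_one_div, ← hs] at h1
    have h2 : 1 / θ = s + 1 := by rw [hs]; field_simp; ring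
    rwa [h2] at h1
  have hGd : ∀ t ∈ Set.Ioo 0 T, HasDerivAt (fun t => f t ^ (-s) - s * M ^ (-s) * t)
      (f' t * (-s) * f t ^ (-s - 1) - s * M ^ (-s) * 1) t := by
    intro t ht
    exact ((hd t ht.1).rpow_const (Or.inl (hfp t ⟨ht.1.le, ht.2.le⟩).ne')).sub
      ((hasDerivAt_id t).const_mul _)
  have hmono : MonotoneOn (fun t => f t ^ (-s) - s * M ^ (-s) * t) (Set.Icc 0 T) := by
    apply monotoneOn_of_deriv_nonneg (convex_Icc 0 T)
    · apply ContinuousOn.sub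
      · exact (hcont.mono (fun t ht => ht.1)).rpow_const (fun t ht => Or.inl (hfp t ht).ne')
      · fun_prop
    · intro t ht
      rw [interior_Icc] at ht
      exact (hGd t ht).differentiableAt.differentiableWithinAt
    · intro t ht
      rw [interior_Icc] at ht
      rw [(hGd t ht).deriv]
      have ht' : t ∈ Set.Icc 0 T := ⟨ht.1.le, ht.2.le⟩
      have hp := hfp t ht'
      have hk := hkey t ht'
      have hi := hineq t ht.1.le
      have e : f t ^ (-s - 1) = (f t ^ (s + 1))⁻¹ := by
        rw [← Real.rpow_neg hp.le]; congr 1; ring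
      rw [e, Real.rpow_neg hM.le]
      have hA : 0 < f t ^ (s + 1) := Real.rpow_pos_of_pos hp _
      have hB : 0 < M ^ s := Real.rpow_pos_of_pos hM _
      have h3 : (M ^ s)⁻¹ ≤ (- f' t) * (f t ^ (s + 1))⁻¹ := by
        rw [← div_eq_mul_inv, le_div_iff₀ hA, inv_mul_le_iff₀ hB]
        exact hk.trans (mul_le_mul_of_nonneg_left (by linarith) hB.le)
      have h4 := mul_le_mul_of_nonneg_left h3 hs0.le
      linarith
  have hfin := hmono ⟨le_refl 0, hT⟩ ⟨hT, le_refl T⟩ hT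
  simp only [mul_zero, sub_zero] at hfin
  have hf0 : 0 < f 0 := hfp 0 ⟨le_refl 0, hT⟩
  have h5 : M ^ (-s) ≤ f 0 ^ (-s) := Real.rpow_le_rpow_of_nonpos hf0 h0 (by linarith)
  have h6 : M ^ (-s) * (1 + s * T) ≤ f T ^ (-s) := by linarith
  rw [Real.rpow_neg hM.le, Real.rpow_neg hpos.le] at h6
  have hB : 0 < M ^ s := Real.rpow_pos_of_pos hM _
  have hC : 0 < f T ^ s := Real.rpow_pos_of_pos hpos _
  rw [inv_mul_le_iff₀ hB, ← div_eq_mul_inv, le_div_iff₀ hC, ← le_div_iff₀' hbase] at h6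
  have h7 := Real.rpow_le_rpow hC.le h6 (by positivity : 0 ≤ 1 / s)
  rwa [Real.div_rpow hB.le hbase.le, ← Real.rpow_mul hpos.le, ← Real.rpow_mul hM.le,
    mul_one_div_cancel hs0.ne', Real.rpow_one, Real.rpow_one] at h7
end
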